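/- arXiv:2407.13052 — 5 statements merged into one kernel-verified Lean document; each statement's English description precedes it below -/
import Mathlib

section
/- Let I and L be finite sets, c : L → ℕ, and suppose feasible assignments exist. Let g, g' : I × L → ℝ be weight functions, let π̂ be a feasible assignment maximizing V_·(g) over feasible assignments, and let π̂' be a feasible assignment maximizing V_·(g') over feasible assignments. Then ‖g' − g‖₁ ≥ V_{π̂}(g) − V_{π̂'}(g) = ∑_{i ∈ I} [ g(i, π̂(i)) − g(i, π̂'(i)) ]. (This is the lower bound of the paper's Lemma 1: the L1 cost of modifying the weights so that π̂' becomes optimal is at least the loss in g-value of π̂' relative to the g-optimum.) -/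
/-- An assignment `π : I → L` is feasible w.r.t. capacities `c` if at most `c l`
refugees are assigned to each location `l`. -/
def Feasible {I L : Type*} [Fintype I] [DecidableEq L] (c : L → ℕ) (π : I → L) : Prop :=
  ∀ l : L, (Finset.univ.filter fun i => π i = l).card ≤ c l

/-- The value `V_π(g) = ∑ i, g (i, π i)` of an assignment `π` under weights `g`. -/
def assignVal {I L : Type*} [Fintype I] (g : I → L → ℝ) (π : I → L) : ℝ :=
  ∑ i, g i (π i)

/-- The difference of two values of a real function is bounded by its L1 norm. -/
theorem sub_le_sum_abs {L : Type*} [Fintype L] [DecidableEq L] (d : L → ℝ) (a b : L) :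
    d a - d b ≤ ∑ l, |d l| := by
  by_cases hab : a = b
  · subst hab
    rw [sub_self]
    exact Finset.sum_nonneg fun l _ => abs_nonneg (d l)
  · calc d a - d b ≤ |d a| + |d b| := by linarith [le_abs_self (d a), neg_abs_le (d b)]
      _ = ∑ l ∈ ({a, b} : Finset L), |d l| :=
        (Finset.sum_pair (f := fun l => |d l|) hab).symm
      _ ≤ ∑ l, |d l| :=
        Finset.sum_le_sum_of_subset_of_nonneg (Finset.subset_univ _)
          fun l _ _ => abs_nonneg (d l)

/-- lower bound of Lemma 1. If `π̂` maximizes value under `g` and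
`π̂'` maximizes value under `g'` (both over feasible assignments), then
`‖g' − g‖₁ ≥ V_{π̂}(g) − V_{π̂'}(g) = ∑ i [g(i, π̂ i) − g(i, π̂' i)]`. -/
theorem inverse_modification_lower_bound {I L : Type*} [Fintype I] [Fintype L] [DecidableEq L]
    (c : L → ℕ) (g g' : I → L → ℝ) (πhat πhat' : I → L)
    (hπhat : Feasible c πhat)
    (hπhatMax : ∀ π : I → L, Feasible c π → assignVal g π ≤ assignVal g πhat)
    (hπhat' : Feasible c πhat')
    (hπhat'Max : ∀ π : I → L, Feasible c π → assignVal g' π ≤ assignVal g' πhat') :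
    assignVal g πhat - assignVal g πhat' ≤ ∑ i : I, ∑ l : L, |g' i l - g i l| := by
  have hopt := hπhat'Max πhat hπhat
  have hbound : ∑ i, ((g' i (πhat' i) - g i (πhat' i)) - (g' i (πhat i) - g i (πhat i)))
      ≤ ∑ i : I, ∑ l : L, |g' i l - g i l| :=
    Finset.sum_le_sum fun i _ => sub_le_sum_abs (fun l => g' i l - g i l) (πhat' i) (πhat i)
  simp only [Finset.sum_sub_distrib] at hbound
  unfold assignVal at hopt ⊢
  linarith
end

section
/- Let I and L be finite sets, c : L → ℕ with ∑_{l ∈ L} c(l) ≥ |I|, and g : I × L → ℝ with g(i,l) ≥ 0 for all i, l. Then there exists a feasible dual solution (u, v) for g whose dual value equals V*(g); that is, strong duality holds for the capacitated assignment problem: min over feasible dual solutions of ∑_{i} u(i) + ∑_{l} c(l)·v(l) equals the maximum value V*(g) of a feasible assignment. -/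
open Finset

lemma exists_pos_le_of_pos {α : Type*} [Finite α] (s : α → ℝ) :
    ∃ ε > 0, ∀ a, 0 < s a → ε ≤ s a := by
  have h : ∀ᶠ ε in nhdsWithin (0 : ℝ) (Set.Ioi 0), ∀ a, 0 < s a → ε ≤ s a := by
    refine Filter.eventually_all.2 fun a => ?_
    by_cases ha : 0 < s a
    · filter_upwards [Ioc_mem_nhdsGT ha] with ε hε _ using hε.2
    · exact Filter.Eventually.of_forall fun _ h => absurd h ha
  obtain ⟨ε, h₁, h₂⟩ := (h.and self_mem_nhdsWithin).exists
  exact ⟨ε, h₂, h₁⟩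

lemma feasible_of_injective {I L : Type*} [Fintype I] [DecidableEq L] {c : L → ℕ}
    {f : I → Σ l, Fin (c l)} (hf : f.Injective) : Feasible c fun i => (f i).1 := by
  classical
  intro l
  calc _ = #((univ.filter fun i => (f i).1 = l).image f) := (card_image_of_injective _ hf).symm
    _ ≤ #(({l} : Finset L).sigma fun l => (univ : Finset (Fin (c l)))) := by
        refine card_le_card fun s hs => ?_
        obtain ⟨i, hi, rfl⟩ := mem_image.1 hs
        simpa using hi
    _ = c l := by simp

section Duality

variable {I L : Type*} [Fintype I] [Fintype L]

/-- The dual objective. -/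
def dualVal (c : L → ℕ) (u : I → ℝ) (v : L → ℝ) : ℝ :=
  ∑ i, u i + ∑ l, (c l : ℝ) * v l

lemma continuous_dualVal (c : L → ℕ) :
    Continuous fun p : (I → ℝ) × (L → ℝ) => dualVal c p.1 p.2 := by
  unfold dualVal
  fun_prop

lemma dualVal_mono (c : L → ℕ) {u u' : I → ℝ} {v v' : L → ℝ}
    (hu : ∀ i, u i ≤ u' i) (hv : ∀ l, v l ≤ v' l) : dualVal c u v ≤ dualVal c u' v' := by
  unfold dualVal
  gcongr with i _ l _
  · exact hu i
  · exact hv l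

lemma dualVal_shift (c : L → ℕ) (hc : Fintype.card I = ∑ l, c l)
    (u : I → ℝ) (v : L → ℝ) (m : ℝ) :
    dualVal c (fun i => u i - m) (fun l => v l + m) = dualVal c u v := by
  have h : (Fintype.card I : ℝ) = ∑ l, (c l : ℝ) := by exact_mod_cast hc
  simp only [dualVal, sum_sub_distrib, mul_add, sum_add_distrib, ← sum_mul, ← h, sum_const,
    card_univ, nsmul_eq_mul]
  ring

/-- Weak duality. -/
lemma assignVal_le_dualVal [DecidableEq L] {c : L → ℕ} {g : I → L → ℝ} {π : I → L}
    (hπ : Feasible c π) {u : I → ℝ} {v : L → ℝ} (hv : ∀ l, 0 ≤ v l)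
    (huv : ∀ i l, g i l ≤ u i + v l) : assignVal g π ≤ dualVal c u v := by
  have h : ∑ i, v (π i) ≤ ∑ l, (c l : ℝ) * v l := by
    rw [← sum_fiberwise' univ π v]
    refine sum_le_sum fun l _ => ?_
    rw [sum_const, nsmul_eq_mul]
    exact mul_le_mul_of_nonneg_right (by exact_mod_cast hπ l) (hv l)
  calc assignVal g π ≤ ∑ i, (u i + v (π i)) := sum_le_sum fun i _ => huv i (π i)
    _ ≤ dualVal c u v := by rw [sum_add_distrib, dualVal]; gcongr

/-- When capacities are balanced and weights are nonnegative, the dual problem attains its minimum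
at a nonnegative solution, even among solutions of arbitrary sign. -/
lemma exists_optimal_dual [Nonempty I] (c : L → ℕ) (hc : Fintype.card I = ∑ l, c l)
    (w : I → L → ℝ) (hw : ∀ i l, 0 ≤ w i l) :
    ∃ (u : I → ℝ) (v : L → ℝ), (∀ i, 0 ≤ u i) ∧ (∀ l, 0 ≤ v l) ∧ (∀ i l, w i l ≤ u i + v l) ∧
      ∀ (u' : I → ℝ) (v' : L → ℝ), (∀ i l, w i l ≤ u' i + v' l) →
        dualVal c u v ≤ dualVal c u' v' := by
  obtain ⟨M, hM⟩ : ∃ M, ∀ p : I × L, w p.1 p.2 ≤ M := by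
    obtain ⟨M, hM⟩ := (Set.finite_range fun p : I × L => w p.1 p.2).bddAbove
    exact ⟨M, fun p => hM ⟨p, rfl⟩⟩
  wlog hM0 : 0 ≤ M generalizing M
  · exact this 0 (fun p => (hM p).trans (le_of_not_ge hM0)) le_rfl
  let K : Set ((I → ℝ) × (L → ℝ)) :=
    Set.Icc 0 (fun _ => M, fun _ => M) ∩ {p | ∀ i l, w i l ≤ p.1 i + p.2 l}
  have hK : IsCompact K := by
    refine isCompact_Icc.inter_right ?_
    simp only [Set.ofPred_forall]
    exact isClosed_iInter fun i => isClosed_iInter fun l =>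
      isClosed_le continuous_const (by fun_prop)
  have hne : K.Nonempty :=
    ⟨(fun _ => M, fun _ => M), ⟨⟨fun _ => hM0, fun _ => hM0⟩, le_rfl⟩,
      fun i l => (hM (i, l)).trans (le_add_of_nonneg_right hM0)⟩
  obtain ⟨⟨u, v⟩, ⟨⟨⟨hu, hv⟩, -⟩, huv⟩, hmin⟩ :=
    hK.exists_isMinOn hne (continuous_dualVal c).continuousOn
  refine ⟨u, v, hu, hv, huv, fun u' v' h' => ?_⟩
  obtain ⟨i₀, hi₀⟩ := Finite.exists_min u'
  have hv' : ∀ l, 0 ≤ v' l + u' i₀ := fun l => by linarith [hw i₀ l, h' i₀ l]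
  have hmem : ((fun i => min (u' i - u' i₀) M, fun l => min (v' l + u' i₀) M) :
      (I → ℝ) × (L → ℝ)) ∈ K := by
    refine ⟨⟨⟨fun i => le_min (sub_nonneg.2 (hi₀ i)) hM0, fun l => le_min (hv' l) hM0⟩,
      fun i => min_le_right _ _, fun l => min_le_right _ _⟩, fun i l => ?_⟩
    have := hM (i, l)
    have := hv' l
    have := hi₀ i
    have := h' i l
    dsimp only at *
    rcases min_cases (u' i - u' i₀) M with h₁ | h₁ <;>
      rcases min_cases (v' l + u' i₀) M with h₂ | h₂ <;> linarith
  calc dualVal c u v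
      ≤ dualVal c (fun i => min (u' i - u' i₀) M) (fun l => min (v' l + u' i₀) M) :=
        isMinOn_iff.1 hmin _ hmem
    _ ≤ dualVal c (fun i => u' i - u' i₀) (fun l => v' l + u' i₀) :=
        dualVal_mono c (fun i => min_le_left _ _) (fun l => min_le_left _ _)
    _ = dualVal c u' v' := dualVal_shift c hc u' v' _

open Classical in
/-- Hall's condition holds for the tight edges of an optimal dual solution. -/
lemma card_le_card_biUnion_tight (c : L → ℕ) (w : I → L → ℝ) {u : I → ℝ} {v : L → ℝ}
    (huv : ∀ i l, w i l ≤ u i + v l)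
    (hmin : ∀ (u' : I → ℝ) (v' : L → ℝ), (∀ i l, w i l ≤ u' i + v' l) →
      dualVal c u v ≤ dualVal c u' v') (A : Finset I) :
    #A ≤ #(A.biUnion fun i => univ.filter fun s : Σ l, Fin (c l) => w i s.1 = u i + v s.1) := by
  obtain ⟨ε, hε, hslack⟩ := exists_pos_le_of_pos fun p : I × L => u p.1 + v p.2 - w p.1 p.2
  let T : Finset L := univ.filter fun l => ∃ i ∈ A, w i l = u i + v l
  have hT : (A.biUnion fun i => univ.filter fun s : Σ l, Fin (c l) => w i s.1 = u i + v s.1) =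
      T.sigma fun l => (univ : Finset (Fin (c l))) := by
    ext s
    simp [T]
  have key := hmin (fun i => u i - if i ∈ A then ε else 0) (fun l => v l + if l ∈ T then ε else 0)
    fun i l => by
      have h₁ := huv i l
      by_cases hi : i ∈ A
      · by_cases hl : l ∈ T
        · simp only [hi, hl, if_true]
          linarith
        · have hne : w i l ≠ u i + v l := fun h => hl (by simpa [T] using ⟨i, hi, h⟩)
          have := hslack (i, l) (sub_pos.2 (lt_of_le_of_ne h₁ hne))
          simp only [hi, hl, if_true, if_false]
          linarith
      · by_cases hl : l ∈ T <;> simp only [hi, hl, if_true, if_false] <;> linarith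
  rw [hT, card_sigma]
  simp only [card_univ, Fintype.card_fin]
  simp only [dualVal, sum_sub_distrib, mul_add, sum_add_distrib, mul_ite, mul_zero, sum_ite_mem,
    univ_inter, sum_const, nsmul_eq_mul, ← sum_mul] at key
  have : (#A : ℝ) * ε ≤ (∑ l ∈ T, (c l : ℝ)) * ε := by linarith
  exact_mod_cast le_of_mul_le_mul_right this hε

/-- With balanced capacities and nonnegative weights, some nonnegative dual solution is tight along
a bijective assignment of agents to capacity slots. -/
lemma exists_dual_equiv_tight (c : L → ℕ) (hc : Fintype.card I = ∑ l, c l)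
    (w : I → L → ℝ) (hw : ∀ i l, 0 ≤ w i l) :
    ∃ (u : I → ℝ) (v : L → ℝ) (e : I ≃ Σ l, Fin (c l)), (∀ i, 0 ≤ u i) ∧ (∀ l, 0 ≤ v l) ∧
      (∀ i l, w i l ≤ u i + v l) ∧ ∀ i, w i (e i).1 = u i + v (e i).1 := by
  classical
  have hcard : Fintype.card I = Fintype.card (Σ l, Fin (c l)) := by simp [hc]
  cases isEmpty_or_nonempty I
  · exact ⟨0, 0, Fintype.equivOfCardEq hcard, by simp, by simp, by simp, by simp⟩
  obtain ⟨u, v, hu, hv, huv, hmin⟩ := exists_optimal_dual c hc w hw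
  obtain ⟨f, hf, hft⟩ := (all_card_le_biUnion_card_iff_exists_injective _).1
    (card_le_card_biUnion_tight c w huv hmin)
  exact ⟨u, v, Equiv.ofBijective f ((Fintype.bijective_iff_injective_and_card f).2 ⟨hf, hcard⟩),
    hu, hv, huv, fun i => by simpa using hft i⟩

/-- Some feasible assignment attains the value of some nonnegative dual solution. -/
lemma exists_feasible_dualVal_le_assignVal [DecidableEq L] (c : L → ℕ)
    (hc : Fintype.card I ≤ ∑ l, c l) (g : I → L → ℝ) (hg : ∀ i l, 0 ≤ g i l) :
    ∃ (π : I → L) (u : I → ℝ) (v : L → ℝ), Feasible c π ∧ (∀ i, 0 ≤ u i) ∧ (∀ l, 0 ≤ v l) ∧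
      (∀ i l, g i l ≤ u i + v l) ∧ dualVal c u v ≤ assignVal g π := by
  -- Dummy agents of weight zero fill the spare capacity.
  let w : I ⊕ Fin (∑ l, c l - Fintype.card I) → L → ℝ := Sum.elim g fun _ _ => 0
  obtain ⟨u, v, e, hu, hv, huv, he⟩ := exists_dual_equiv_tight c
    (by rw [Fintype.card_sum, Fintype.card_fin]; omega) w
    (by rintro (i | k) l <;> simp [w, hg])
  refine ⟨fun i => (e (.inl i)).1, fun i => u (.inl i), v,
    feasible_of_injective (e.injective.comp Sum.inl_injective), fun i => hu _, hv,
    fun i l => huv (.inl i) l, ?_⟩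
  have hs : ∑ j, v (e j).1 = ∑ l, (c l : ℝ) * v l := by
    rw [e.sum_comp fun s => v s.1, Fintype.sum_sigma]
    simp
  have ht : ∑ j, w j (e j).1 = assignVal g fun i => (e (.inl i)).1 := by
    simp [w, assignVal, Fintype.sum_sum_type]
  have hu' : 0 ≤ ∑ k, u (.inr k) := sum_nonneg fun k _ => hu _
  rw [← ht, sum_congr rfl fun j _ => he j, sum_add_distrib, hs, Fintype.sum_sum_type, dualVal]
  linarith

end Duality

/-- strong duality. If `∑ l, c l ≥ |I|` and `g ≥ 0`, then there is a
feasible dual solution `(u, v)` whose dual value equals the maximum assignment value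
`V*(g)`; moreover every feasible dual solution has dual value at least `V*(g)`, i.e.
min over feasible duals equals max over feasible assignments. -/
theorem strong_duality {I L : Type*} [Fintype I] [Fintype L] [DecidableEq L]
    (c : L → ℕ) (hc : Fintype.card I ≤ ∑ l : L, c l)
    (g : I → L → ℝ) (hg : ∀ i l, 0 ≤ g i l) :
    ∃ (Vstar : ℝ) (u : I → ℝ) (v : L → ℝ),
      IsGreatest {x | ∃ π : I → L, Feasible c π ∧ x = assignVal g π} Vstar ∧
      (∀ i, 0 ≤ u i) ∧ (∀ l, 0 ≤ v l) ∧ (∀ i l, g i l ≤ u i + v l) ∧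
      (∑ i : I, u i + ∑ l : L, (c l : ℝ) * v l = Vstar) ∧
      (∀ (u' : I → ℝ) (v' : L → ℝ), (∀ i, 0 ≤ u' i) → (∀ l, 0 ≤ v' l) →
        (∀ i l, g i l ≤ u' i + v' l) →
        Vstar ≤ ∑ i : I, u' i + ∑ l : L, (c l : ℝ) * v' l) := by
  obtain ⟨π, u, v, hπ, hu, hv, huv, hle⟩ := exists_feasible_dualVal_le_assignVal c hc g hg
  refine ⟨assignVal g π, u, v, ⟨⟨π, hπ, rfl⟩, ?_⟩, hu, hv, huv,
    hle.antisymm (assignVal_le_dualVal hπ hv huv),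
    fun u' v' _ hv' huv' => assignVal_le_dualVal hπ hv' huv'⟩
  rintro _ ⟨π', hπ', rfl⟩
  exact (assignVal_le_dualVal hπ' hv huv).trans hle
end

section
/- Let I and L be finite sets, c : L → ℕ with ∑_{l ∈ L} c(l) = |I|, and g : I × L → ℝ. Let (u, v) be a feasible dual solution for g whose dual value equals V*(g), let π' be any feasible assignment, and define ĝ(i,l) = u(i) + v(l) if π'(i) = l and ĝ(i,l) = g(i,l) otherwise. Then π' is an optimal feasible assignment under the modified weights ĝ, with V_{π'}(ĝ) = V*(ĝ) = V*(g). -/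
/-- A feasible assignment fills every location to capacity when the total capacity is `|I|`. -/
theorem Feasible.card_fiber_eq {I L : Type*} [Fintype I] [Fintype L] [DecidableEq L]
    {c : L → ℕ} (hc : ∑ l : L, c l = Fintype.card I) {π : I → L} (hπ : Feasible c π) (l : L) :
    (Finset.univ.filter fun i => π i = l).card = c l := by
  refine (Finset.sum_eq_sum_iff_of_le fun l _ => hπ l).mp ?_ l (Finset.mem_univ l)
  rw [hc, ← Finset.card_univ]
  exact (Finset.card_eq_sum_card_fiberwise fun i _ => Finset.mem_univ (π i)).symm

/-- Under tight capacities, the location prices paid by a feasible assignment sum to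
`∑ l, c l * v l`. -/
theorem Feasible.sum_comp_eq {I L : Type*} [Fintype I] [Fintype L] [DecidableEq L]
    {c : L → ℕ} (hc : ∑ l : L, c l = Fintype.card I) {π : I → L} (hπ : Feasible c π)
    (v : L → ℝ) : ∑ i, v (π i) = ∑ l, (c l : ℝ) * v l := by
  rw [← Finset.sum_fiberwise' Finset.univ π v]
  simp [hπ.card_fiber_eq hc]

/-- Let `(u, v)` be a feasible dual solution for `g` with dual value
`V*(g)`, `π'` any feasible assignment, and `ĝ (i,l) = u i + v l` if `π' i = l`, else
`g (i,l)`. Then `π'` is an optimal feasible assignment under `ĝ`, with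
`V_{π'}(ĝ) = V*(ĝ) = V*(g)`. -/
theorem modified_weights_make_optimal {I L : Type*} [Fintype I] [Fintype L] [DecidableEq L]
    (c : L → ℕ) (hc : ∑ l : L, c l = Fintype.card I)
    (g : I → L → ℝ) (u : I → ℝ) (v : L → ℝ) (Vstar : ℝ)
    (hu : ∀ i, 0 ≤ u i) (hv : ∀ l, 0 ≤ v l)
    (hdualfeas : ∀ i l, g i l ≤ u i + v l)
    (hV : IsGreatest {x | ∃ π : I → L, Feasible c π ∧ x = assignVal g π} Vstar)
    (hdualval : ∑ i : I, u i + ∑ l : L, (c l : ℝ) * v l = Vstar)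
    (π' : I → L) (hπ' : Feasible c π')
    (ghat : I → L → ℝ)
    (hghat : ∀ i l, ghat i l = if π' i = l then u i + v l else g i l) :
    (∀ π : I → L, Feasible c π → assignVal ghat π ≤ assignVal ghat π') ∧
    assignVal ghat π' = Vstar ∧
    IsGreatest {x | ∃ π : I → L, Feasible c π ∧ x = assignVal ghat π} Vstar := by
  have dual_sum : ∀ π : I → L, Feasible c π → ∑ i, (u i + v (π i)) = Vstar := fun π hπ => by
    rw [Finset.sum_add_distrib, hπ.sum_comp_eq hc, hdualval]
  have val_eq : assignVal ghat π' = Vstar := by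
    rw [← dual_sum π' hπ']
    simp [assignVal, hghat]
  have val_le : ∀ π : I → L, Feasible c π → assignVal ghat π ≤ Vstar := fun π hπ => by
    rw [← dual_sum π hπ]
    refine Finset.sum_le_sum fun i _ => ?_
    rw [hghat]
    split_ifs
    exacts [le_rfl, hdualfeas i (π i)]
  refine ⟨fun π hπ => (val_le π hπ).trans_eq val_eq.symm, val_eq, ⟨π', hπ', val_eq.symm⟩, ?_⟩
  rintro _ ⟨π, hπ, rfl⟩
  exact val_le π hπ
end

section
/- Let I and L be finite sets, c : L → ℕ with ∑_{l ∈ L} c(l) = |I|, and let ĝ : I × L → ℝ be weights under which a feasible assignment π' is optimal, i.e., V_{π'}(ĝ) = V*(ĝ). For ε > 0, define perturbed weights ğ(i,l) = ĝ(i,l) + ε if π'(i) = l and ğ(i,l) = ĝ(i,l) otherwise. Then π' is the unique optimal feasible assignment under ğ: for every feasible assignment π ≠ π', V_π(ğ) < V_{π'}(ğ). -/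
/-- If the feasible assignment `π'` is optimal under weights `ĝ`,
then after adding `ε > 0` to the entries `(i, π' i)`, `π'` becomes the *unique*
optimal feasible assignment: every feasible `π ≠ π'` has strictly smaller value. -/
theorem perturbation_unique_optimum {I L : Type*} [Fintype I] [Fintype L] [DecidableEq L]
    (c : L → ℕ) (hc : ∑ l : L, c l = Fintype.card I)
    (ghat : I → L → ℝ) (π' : I → L) (hπ' : Feasible c π')
    (hopt : ∀ π : I → L, Feasible c π → assignVal ghat π ≤ assignVal ghat π')
    (ε : ℝ) (hε : 0 < ε)
    (gbreve : I → L → ℝ)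
    (hgbreve : ∀ i l, gbreve i l = if π' i = l then ghat i l + ε else ghat i l) :
    ∀ π : I → L, Feasible c π → π ≠ π' → assignVal gbreve π < assignVal gbreve π' := by
  intro π hπ hne
  obtain ⟨j, hj⟩ := Function.ne_iff.mp hne
  have h_gain : assignVal gbreve π - assignVal ghat π <
      assignVal gbreve π' - assignVal ghat π' := by
    simp only [assignVal, ← Finset.sum_sub_distrib]
    refine Finset.sum_lt_sum (fun i _ => ?_) ⟨j, Finset.mem_univ j, ?_⟩
    · rw [hgbreve, hgbreve, if_pos rfl]
      split_ifs <;> linarith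
    · rw [hgbreve, hgbreve, if_pos rfl, if_neg (Ne.symm hj)]
      linarith
  linarith [hopt π hπ]
end

section
/- Let I and L be finite sets, c : L → ℕ with ∑_{l ∈ L} c(l) = |I|, and g : I × L → ℝ. Let ℓ : I → L be a default assignment and y : I → {0,1} realized outcomes, and let π' be a feasible assignment with π'(i) = ℓ(i) for every i with y(i) = 1. Let (u, v) be a feasible dual solution for g whose dual value equals V*(g), and for ε > 0 define ğ(i,l) = u(i) + v(l) + ε if π'(i) = l and ğ(i,l) = g(i,l) otherwise. Then every feasible assignment π̂ maximizing V_·(ğ) over feasible assignments satisfies π̂(i) = ℓ(i) for all i with y(i) = 1 (indeed π̂ = π'); that is, every maximizer of predicted utility under the modified weights ğ is counterfactually harmless with respect to (ℓ, y). (This is the harmlessness guarantee of the paper's Theorem 1.) -/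
/-- harmlessness guarantee of Theorem 1. Let `π'` be a feasible
assignment agreeing with the default assignment `ℓ` on every refugee with realized
outcome `y i = 1`, let `(u, v)` be a feasible dual solution for `g` with dual value
`V*(g)`, and for `ε > 0` let `ğ (i,l) = u i + v l + ε` if `π' i = l`, else `g (i,l)`.
Then every feasible assignment maximizing value under `ğ` equals `π'`, and in
particular is counterfactually harmless with respect to `(ℓ, y)`. -/
theorem modified_weights_harmless {I L : Type*} [Fintype I] [Fintype L] [DecidableEq L]
    (c : L → ℕ) (hc : ∑ l : L, c l = Fintype.card I)
    (g : I → L → ℝ) (ℓ : I → L) (y : I → ℕ) (hy : ∀ i, y i = 0 ∨ y i = 1)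
    (π' : I → L) (hπ' : Feasible c π') (hπ'harmless : ∀ i, y i = 1 → π' i = ℓ i)
    (u : I → ℝ) (v : L → ℝ) (hu : ∀ i, 0 ≤ u i) (hv : ∀ l, 0 ≤ v l)
    (hdualfeas : ∀ i l, g i l ≤ u i + v l)
    (Vstar : ℝ)
    (hV : IsGreatest {x | ∃ π : I → L, Feasible c π ∧ x = assignVal g π} Vstar)
    (hdualval : ∑ i : I, u i + ∑ l : L, (c l : ℝ) * v l = Vstar)
    (ε : ℝ) (hε : 0 < ε)
    (gbreve : I → L → ℝ)
    (hgbreve : ∀ i l, gbreve i l = if π' i = l then u i + v l + ε else g i l) :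
    ∀ πhat : I → L, Feasible c πhat →
      (∀ π : I → L, Feasible c π → assignVal gbreve π ≤ assignVal gbreve πhat) →
      πhat = π' ∧ ∀ i, y i = 1 → πhat i = ℓ i := by
  intro πhat hπhat hmax
  have heq : πhat = π' := by
    by_contra hne
    obtain ⟨j, hj⟩ := Function.ne_iff.1 hne
    have hlt : assignVal gbreve πhat < ∑ i, (u i + v (πhat i) + ε) := by
      refine Finset.sum_lt_sum (fun i _ => ?_) ⟨j, Finset.mem_univ j, ?_⟩
      · rw [hgbreve]
        split_ifs
        · exact le_rfl
        · linarith [hdualfeas i (πhat i)]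
      · rw [hgbreve, if_neg (Ne.symm hj)]
        linarith [hdualfeas j (πhat j)]
    have hval : assignVal gbreve π' = ∑ i, (u i + v (π' i) + ε) :=
      Finset.sum_congr rfl fun i _ => by rw [hgbreve, if_pos rfl]
    have hle := hmax π' hπ'
    simp only [Finset.sum_add_distrib, hπhat.sum_comp_eq hc, hπ'.sum_comp_eq hc] at hlt hval
    linarith
  exact ⟨heq, fun i hi => heq ▸ hπ'harmless i hi⟩
end
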